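/- Every unitary error basis yields a tight teleportation scheme. Let d ≥ 1 and let (U_i)_{i<d²} be a unitary error basis on ℂ^d. Set Ω := (1/√d)∑_{k<d} e_k⊗e_k and Φ_i := (U_i⊗I_d)Ω. Then: (1) the vectors (Φ_i)_{i<d²} form an orthonormal basis of ℂ^d⊗ℂ^d, so (|Φ_i⟩⟨Φ_i|)_{i<d²} is a von Neumann measurement; and (2) the teleportation identity holds: for every ρ ∈ M_d(ℂ), ∑_{i<d²} U_i·[(⟨Φ_i|⊗I_d)(ρ⊗|Ω⟩⟨Ω|)(|Φ_i⟩⊗I_d)]·U_i† = ρ, where (⟨Φ_i|⊗I_d)(·)(|Φ_i⟩⊗I_d) maps M_d(ℂ)⊗M_d(ℂ)⊗M_d(ℂ) to M_d(ℂ) by contracting the first two tensor factors against Φ_i. -/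

import Mathlib

noncomputable section

open Matrix Kronecker
open scoped ComplexOrder

namespace EntInvPaper

/-- The matrix algebra `M_n(ℂ)` with row/column index type `n`. -/
abbrev Mat (n : Type) : Type := Matrix n n ℂ

/-- The amplification `id_{M_t} ⊗ Φ` of a linear map between matrix algebras,
as a plain function on matrices. -/
def amplL {n m : Type} (t : Type) (Φ : Mat n →ₗ[ℂ] Mat m) (X : Mat (t × n)) : Mat (t × m) :=
  Matrix.of fun p q => Φ (Matrix.of fun x y => X (p.1, x) (q.1, y)) p.2 q.2

/-- The amplification `Φ ⊗ id_{M_t}` of a linear map between matrix algebras. -/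
def amplR {n m : Type} (t : Type) (Φ : Mat n →ₗ[ℂ] Mat m) (X : Mat (n × t)) : Mat (m × t) :=
  Matrix.of fun p q => Φ (Matrix.of fun x y => X (x, p.2) (y, q.2)) p.1 q.1

/-- Complete positivity: every amplification `id_{M_k} ⊗ Φ` preserves positive
semidefiniteness. -/
def IsCP {n m : Type} [Fintype n] [Fintype m] (Φ : Mat n →ₗ[ℂ] Mat m) : Prop :=
  ∀ (k : ℕ) (X : Mat (Fin k × n)), X.PosSemidef → (amplL (Fin k) Φ X).PosSemidef

/-- A channel is a completely positive trace-preserving linear map. -/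
def IsChannel {n m : Type} [Fintype n] [Fintype m] (Φ : Mat n →ₗ[ℂ] Mat m) : Prop :=
  IsCP Φ ∧ ∀ X : Mat n, (Φ X).trace = X.trace

/-- A state: a positive semidefinite matrix of trace one. -/
def IsState {n : Type} [Fintype n] (ρ : Mat n) : Prop :=
  ρ.PosSemidef ∧ ρ.trace = 1

/-- The outer product `|v⟩⟨v|`. -/
def outer {n : Type} (v : n → ℂ) : Mat n :=
  Matrix.vecMulVec v (star v)

/-- `x ⊗ W`, with the tensor factors regrouped as `(a × h₁) × h₂`. -/
def tensorState {a h₁ h₂ : Type} (x : Mat a) (W : Mat (h₁ × h₂)) : Mat ((a × h₁) × h₂) :=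
  Matrix.reindex (Equiv.prodAssoc a h₁ h₂).symm (Equiv.prodAssoc a h₁ h₂).symm (x ⊗ₖ W)

/-- Swap the two tensor factors of a bipartite operator. -/
def swapState {h₁ h₂ : Type} (W : Mat (h₁ × h₂)) : Mat (h₂ × h₁) :=
  Matrix.reindex (Equiv.prodComm h₁ h₂) (Equiv.prodComm h₁ h₂) W

/-- Partial trace over the first tensor factor. -/
def ptraceFst {p t : Type} [Fintype p] (X : Mat (p × t)) : Mat t :=
  Matrix.of fun s s' => ∑ u : p, X (u, s) (u, s')

/-- Partial trace over the second tensor factor. -/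
def ptraceSnd {s t : Type} [Fintype t] (X : Mat (s × t)) : Mat s :=
  Matrix.of fun i i' => ∑ k : t, X (i, k) (i', k)

/-- `N` is an entanglement-left inverse of `M` with respect to the resource state `W`:
`N((M ⊗ id)(x ⊗ W)) = x` for all `x`. -/
def EntLeftInv {a b h₁ h₂ : Type} (M : Mat (a × h₁) →ₗ[ℂ] Mat b)
    (N : Mat (b × h₂) →ₗ[ℂ] Mat a) (W : Mat (h₁ × h₂)) : Prop :=
  ∀ x : Mat a, N (amplR h₂ M (tensorState x W)) = x

/-- `N` is an entanglement-right inverse of `M` with respect to `W`: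
`M((N ⊗ id)(y ⊗ Wᵠ)) = y` for all `y`, where `Wᵠ` is `W` with the factors swapped. -/
def EntRightInv {a b h₁ h₂ : Type} (M : Mat (a × h₁) →ₗ[ℂ] Mat b)
    (N : Mat (b × h₂) →ₗ[ℂ] Mat a) (W : Mat (h₁ × h₂)) : Prop :=
  ∀ y : Mat b, M (amplR h₁ N (tensorState y (swapState W))) = y

/-- `M` is entanglement-reversible with respect to `W`. -/
def EntReversible {a b h₁ h₂ : Type} [Fintype a] [Fintype b] [Fintype h₁] [Fintype h₂]
    (M : Mat (a × h₁) →ₗ[ℂ] Mat b) (W : Mat (h₁ × h₂)) : Prop :=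
  ∃ N : Mat (b × h₂) →ₗ[ℂ] Mat a, IsChannel N ∧ EntLeftInv M N W

/-- `M` is entanglement-invertible with respect to `W`. -/
def EntInvertible {a b h₁ h₂ : Type} [Fintype a] [Fintype b] [Fintype h₁] [Fintype h₂]
    (M : Mat (a × h₁) →ₗ[ℂ] Mat b) (W : Mat (h₁ × h₂)) : Prop :=
  ∃ N : Mat (b × h₂) →ₗ[ℂ] Mat a, IsChannel N ∧ EntLeftInv M N W ∧ EntRightInv M N W

/-- The canonical maximally entangled unit vector `Ω = (1/√h) ∑ₖ eₖ ⊗ eₖ`. -/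
def omegaVec (h : ℕ) : Fin h × Fin h → ℂ :=
  fun p => if p.1 = p.2 then ((Real.sqrt h : ℝ) : ℂ)⁻¹ else 0

/-- The canonical maximally entangled state `|Ω⟩⟨Ω|`. -/
def canME (h : ℕ) : Mat (Fin h × Fin h) := outer (omegaVec h)

/-- The vector `w_ω = ∑ₖ eₖ ⊗ ω eₖ` associated to a linear map `ω : ℂ^{h₁} → ℂ^{h₂}`. -/
def pureVec {h₁ h₂ : Type} (ω : Matrix h₂ h₁ ℂ) : h₁ × h₂ → ℂ := fun p => ω p.2 p.1

/-- The pure state `|w_ω⟩⟨w_ω|` defined by `ω`. -/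
def pureState {h₁ h₂ : Type} (ω : Matrix h₂ h₁ ℂ) : Mat (h₁ × h₂) := outer (pureVec ω)

/-- `V` is a Stinespring dilation of the channel `M`, with environment the second
tensor factor `ℂ^e`: `V` is an isometry and `M z = Tr_{ℂ^e}(V z V†)`. -/
def IsDilation {a h b e : ℕ} (M : Mat (Fin a × Fin h) →ₗ[ℂ] Mat (Fin b))
    (V : Matrix (Fin b × Fin e) (Fin a × Fin h) ℂ) : Prop :=
  Vᴴ * V = 1 ∧ ∀ z : Mat (Fin a × Fin h), M z = ptraceSnd (V * z * Vᴴ)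

/-- Minimality of a dilation: the vectors `(⟨y| ⊗ I)Vξ` span the environment. -/
def IsMinimalDilation {a h b e : ℕ} (V : Matrix (Fin b × Fin e) (Fin a × Fin h) ℂ) : Prop :=
  Submodule.span ℂ { v : Fin e → ℂ |
    ∃ (y : Fin b → ℂ) (ξ : Fin a × Fin h → ℂ),
      v = fun f => ∑ j, (starRingEnd ℂ) (y j) * (V *ᵥ ξ) (j, f) } = ⊤

/-- The rearrangement `Ṽ` of `V : ℂ^a ⊗ ℂ^h → ℂ^b ⊗ ℂ^e`, with entries
`Ṽ_{(k,j),(i,f)} = V_{(j,f),(i,k)}`. -/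
def rearrange {a b h e : ℕ} (V : Matrix (Fin b × Fin e) (Fin a × Fin h) ℂ) :
    Matrix (Fin h × Fin b) (Fin a × Fin e) ℂ :=
  Matrix.of fun p q => V (p.2, q.2) (q.1, p.1)

/-- The candidate bi-isometry `S = (ω ⊗ I_b) · Ṽ · (I_a ⊗ κ)`. -/
def biIsometryCandidate {a b h e : ℕ} (ω : Mat (Fin h))
    (V : Matrix (Fin b × Fin e) (Fin a × Fin h) ℂ) (κ : Mat (Fin e)) :
    Matrix (Fin h × Fin b) (Fin a × Fin e) ℂ :=
  (ω ⊗ₖ (1 : Mat (Fin b))) * rearrange V * ((1 : Mat (Fin a)) ⊗ₖ κ)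

/-- The contraction `(⟨Φ| ⊗ I)X(|Φ⟩ ⊗ I)` of the first tensor factor of `X`
against the vector `Φ`. -/
def contract {p t : Type} [Fintype p] (Φ : p → ℂ) (X : Mat (p × t)) : Mat t :=
  Matrix.of fun s s' => ∑ u : p, ∑ u' : p, (starRingEnd ℂ) (Φ u) * X (u, s) (u', s') * Φ u'

/-- Conjugation `X ↦ C X C†` as a linear map. -/
def conjBy {p q : Type} [Fintype q] (C : Matrix p q ℂ) : Mat q →ₗ[ℂ] Mat p where
  toFun X := C * X * Cᴴ
  map_add' X Y := by
    show C * (X + Y) * Cᴴ = C * X * Cᴴ + C * Y * Cᴴ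
    rw [Matrix.mul_add, Matrix.add_mul]
  map_smul' c X := by
    show C * (c • X) * Cᴴ = c • (C * X * Cᴴ)
    rw [Matrix.mul_smul, Matrix.smul_mul]

end EntInvPaper

noncomputable section
open Matrix Kronecker
open scoped ComplexOrder
namespace EntInvPaper

/-- The vector `(A ⊗ I)Ω` has entries `A a b / √d`. -/
lemma kronecker_one_mulVec_omegaVec {d : ℕ} (A : Mat (Fin d)) (p : Fin d × Fin d) :
    ((A ⊗ₖ (1 : Mat (Fin d))) *ᵥ omegaVec d) p = ((Real.sqrt d : ℝ) : ℂ)⁻¹ * A p.1 p.2 := by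
  simp [Matrix.mulVec, dotProduct, omegaVec, Fintype.sum_prod_type, Matrix.one_apply, mul_comm]

lemma inv_sqrt_mul_inv_sqrt (d : ℕ) :
    ((Real.sqrt d : ℝ) : ℂ)⁻¹ * ((Real.sqrt d : ℝ) : ℂ)⁻¹ = (d : ℂ)⁻¹ := by
  rw [← mul_inv, ← Complex.ofReal_mul, Real.mul_self_sqrt d.cast_nonneg, Complex.ofReal_natCast]

/-- `⟨(A ⊗ I)Ω, (B ⊗ I)Ω⟩` is the normalized Hilbert–Schmidt inner product of `A` and `B`. -/
lemma star_dotProduct_kronecker_one_mulVec_omegaVec {d : ℕ} (A B : Mat (Fin d)) :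
    star ((A ⊗ₖ (1 : Mat (Fin d))) *ᵥ omegaVec d) ⬝ᵥ
      ((B ⊗ₖ (1 : Mat (Fin d))) *ᵥ omegaVec d) = (d : ℂ)⁻¹ * (Aᴴ * B).trace := by
  simp only [dotProduct, Pi.star_apply, kronecker_one_mulVec_omegaVec, Matrix.trace,
    Matrix.diag_apply, Matrix.mul_apply, Matrix.conjTranspose_apply, Fintype.sum_prod_type,
    Finset.mul_sum]
  rw [Finset.sum_comm]
  refine Finset.sum_congr rfl fun b _ => Finset.sum_congr rfl fun a _ => ?_
  rw [← inv_sqrt_mul_inv_sqrt]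
  simp only [star_mul', star_inv₀, RCLike.star_def, Complex.conj_ofReal]
  ring

/-- An orthonormal family of full cardinality resolves the identity. -/
lemma sum_outer_eq_one {n m : Type} [Fintype n] [DecidableEq n] [Fintype m] [DecidableEq m]
    (hcard : Fintype.card n = Fintype.card m) (v : m → n → ℂ)
    (hv : ∀ i j, star (v i) ⬝ᵥ v j = if i = j then 1 else 0) :
    ∑ i, outer (v i) = 1 := by
  have hleft : (Matrix.of fun p i => v i p)ᴴ * (Matrix.of fun p i => v i p) = 1 := by
    ext i j
    simpa [Matrix.mul_apply, Matrix.one_apply, dotProduct] using hv i j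
  have hright := (Matrix.mul_eq_one_comm_of_card_eq _ _ _ hcard.symm).mp hleft
  rw [← hright]
  ext p q
  simp [outer, Matrix.sum_apply, Matrix.mul_apply, Matrix.vecMulVec_apply]

/-- Contracting `ρ ⊗ |Ω⟩⟨Ω|` against `(A ⊗ I)Ω` yields `A†ρA / d²`. -/
lemma contract_tensorState_canME {d : ℕ} (A ρ : Mat (Fin d)) :
    contract ((A ⊗ₖ (1 : Mat (Fin d))) *ᵥ omegaVec d) (tensorState ρ (canME d)) =
      ((d : ℂ)⁻¹ * (d : ℂ)⁻¹) • (Aᴴ * ρ * A) := by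
  ext s t
  simp only [contract, tensorState, canME, outer, omegaVec, kronecker_one_mulVec_omegaVec,
    Matrix.of_apply, Matrix.reindex_apply, Matrix.submatrix_apply, Equiv.symm_symm,
    Equiv.prodAssoc_apply, Matrix.kroneckerMap_apply, Matrix.vecMulVec_apply, Pi.star_apply,
    Fintype.sum_prod_type, Matrix.smul_apply, smul_eq_mul, Matrix.mul_apply,
    Matrix.conjTranspose_apply, Finset.sum_mul, Finset.mul_sum]
  simp only [apply_ite star, star_zero, mul_ite, ite_mul, mul_zero, zero_mul,
    Finset.sum_ite_eq', Finset.sum_ite_irrel, Finset.sum_const_zero, Finset.mem_univ, if_true]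
  rw [Finset.sum_comm]
  refine Finset.sum_congr rfl fun b _ => Finset.sum_congr rfl fun a _ => ?_
  rw [← inv_sqrt_mul_inv_sqrt]
  simp only [map_mul, map_inv₀, star_inv₀, RCLike.star_def, Complex.conj_ofReal]
  ring

/-- **Every unitary error basis yields a tight teleportation scheme.**
The vectors `Φᵢ = (Uᵢ ⊗ I)Ω` form an orthonormal basis of `ℂ^d ⊗ ℂ^d` (so the
projections `|Φᵢ⟩⟨Φᵢ|` form a von Neumann measurement), and the teleportation
identity `∑ᵢ Uᵢ·[(⟨Φᵢ| ⊗ I)(ρ ⊗ |Ω⟩⟨Ω|)(|Φᵢ⟩ ⊗ I)]·Uᵢ† = ρ` holds. -/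
theorem ueb_teleportation
    (d : ℕ) (hd : 1 ≤ d)
    (U : Fin (d ^ 2) → Mat (Fin d))
    (hU : ∀ i, U i ∈ Matrix.unitaryGroup (Fin d) ℂ)
    (horth : ∀ i j, ((d : ℂ))⁻¹ * ((U i)ᴴ * U j).trace = if i = j then 1 else 0) :
    (∀ i j,
      star ((U i ⊗ₖ (1 : Mat (Fin d))) *ᵥ omegaVec d) ⬝ᵥ
        ((U j ⊗ₖ (1 : Mat (Fin d))) *ᵥ omegaVec d) = if i = j then 1 else 0) ∧
    (∑ i, outer ((U i ⊗ₖ (1 : Mat (Fin d))) *ᵥ omegaVec d) = 1) ∧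
    (∀ ρ : Mat (Fin d),
      ∑ i, U i *
          contract ((U i ⊗ₖ (1 : Mat (Fin d))) *ᵥ omegaVec d)
            (tensorState ρ (canME d)) * (U i)ᴴ = ρ) := by
  have hd0 : (d : ℂ) ≠ 0 := Nat.cast_ne_zero.mpr (by omega)
  have hΦ : ∀ i j,
      star ((U i ⊗ₖ (1 : Mat (Fin d))) *ᵥ omegaVec d) ⬝ᵥ
        ((U j ⊗ₖ (1 : Mat (Fin d))) *ᵥ omegaVec d) = if i = j then 1 else 0 := fun i j => by
    rw [star_dotProduct_kronecker_one_mulVec_omegaVec, horth]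
  refine ⟨hΦ, sum_outer_eq_one (by simp [sq]) _ hΦ, fun ρ => ?_⟩
  have hterm : ∀ i, U i * contract ((U i ⊗ₖ (1 : Mat (Fin d))) *ᵥ omegaVec d)
      (tensorState ρ (canME d)) * (U i)ᴴ = ((d : ℂ)⁻¹ * (d : ℂ)⁻¹) • ρ := fun i => by
    have hUi : U i * (U i)ᴴ = 1 := Matrix.mem_unitaryGroup_iff.mp (hU i)
    rw [contract_tensorState_canME, Matrix.mul_smul, Matrix.smul_mul]
    congr 1
    calc U i * ((U i)ᴴ * ρ * U i) * (U i)ᴴ = U i * (U i)ᴴ * ρ * (U i * (U i)ᴴ) := by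
          simp only [Matrix.mul_assoc]
      _ = ρ := by rw [hUi, Matrix.one_mul, Matrix.mul_one]
  simp only [hterm, Finset.sum_const, Finset.card_univ, Fintype.card_fin]
  rw [← Nat.cast_smul_eq_nsmul ℂ, smul_smul]
  have hscalar : ((d ^ 2 : ℕ) : ℂ) * ((d : ℂ)⁻¹ * (d : ℂ)⁻¹) = 1 := by
    push_cast
    field_simp
  rw [hscalar, one_smul]

end EntInvPaper
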